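/- Let γ>0, ε ∈ (0,1) and let (u_ε,P_ε) be a smooth solution of the viscous short pulse system on the half-line. Define F_ε(t,x) = ∫₀ˣ P_ε(t,y) dy. Then for each t>0 the limit lim_{x→∞} F_ε(t,x) exists and equals ∫₀^∞ P_ε(t,y) dy = (ε/γ) ∂ₜ∂ₓP_ε(t,0) + (ε/γ) ∂ₓu_ε(t,0). -/

import Mathlib

open MeasureTheory Filter Set

/-- The viscous short pulse system on the half-line `(0,∞)`:
`∂ₜu − (1/2)u²∂ₓu = γP + ε∂ₓₓu`, `−ε∂ₓₓP + ∂ₓP = u`, with homogeneous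
boundary conditions `u(t,0) = P(t,0) = 0`, `u(t,·), ∂ₓu(t,·) ∈ L²(0,∞)` and
decay of `u, ∂ₓu, P, ∂ₓP` as `x → ∞`.  The functions `ut, ux, uxx, Px, Pxx`
are the indicated partial derivatives of `u` and `P`. -/
structure ViscousSPEHalf (γ ε : ℝ) (u P ut ux uxx Px Pxx : ℝ → ℝ → ℝ) : Prop where
  hut : ∀ t x : ℝ, HasDerivAt (fun τ => u τ x) (ut t x) t
  hux : ∀ t x : ℝ, HasDerivAt (fun y => u t y) (ux t x) x
  huxx : ∀ t x : ℝ, HasDerivAt (fun y => ux t y) (uxx t x) x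
  hPx : ∀ t x : ℝ, HasDerivAt (fun y => P t y) (Px t x) x
  hPxx : ∀ t x : ℝ, HasDerivAt (fun y => Px t y) (Pxx t x) x
  hequ : ∀ t > (0:ℝ), ∀ x > (0:ℝ),
    ut t x - 1 / 2 * (u t x) ^ 2 * ux t x = γ * P t x + ε * uxx t x
  heqP : ∀ t > (0:ℝ), ∀ x > (0:ℝ), -ε * Pxx t x + Px t x = u t x
  hbu : ∀ t : ℝ, u t 0 = 0
  hbP : ∀ t : ℝ, P t 0 = 0
  huL2 : ∀ t > (0:ℝ), MeasureTheory.IntegrableOn (fun x => (u t x) ^ 2) (Set.Ioi 0)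
  huxL2 : ∀ t > (0:ℝ), MeasureTheory.IntegrableOn (fun x => (ux t x) ^ 2) (Set.Ioi 0)
  hdu : ∀ t > (0:ℝ), Filter.Tendsto (fun x => u t x) Filter.atTop (nhds 0)
  hdux : ∀ t > (0:ℝ), Filter.Tendsto (fun x => ux t x) Filter.atTop (nhds 0)
  hdP : ∀ t > (0:ℝ), Filter.Tendsto (fun x => P t x) Filter.atTop (nhds 0)
  hdPx : ∀ t > (0:ℝ), Filter.Tendsto (fun x => Px t x) Filter.atTop (nhds 0)

/-- A function which is continuous on `[0, ∞)` and vanishes at infinity is bounded there. -/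
lemma exists_norm_le_of_continuousOn_of_tendsto_zero {E : Type*} [NormedAddCommGroup E]
    {y : ℝ → E}
    (hc : ContinuousOn y (Ici 0)) (hlim : Tendsto y atTop (nhds 0)) :
    ∃ M : ℝ, ∀ x ≥ (0 : ℝ), ‖y x‖ ≤ M := by
  have hev : ∀ᶠ x in atTop, ‖y x‖ ≤ 1 := by
    have h0 : Tendsto (fun x => ‖y x‖) atTop (nhds 0) := by simpa using hlim.norm
    exact (h0.eventually (gt_mem_nhds one_pos)).mono fun x hx => le_of_lt hx
  obtain ⟨R, hR⟩ := eventually_atTop.1 hev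
  obtain ⟨C, hC⟩ := (isCompact_Icc (a := (0 : ℝ)) (b := R)).exists_bound_of_continuousOn
    (hc.mono Icc_subset_Ici_self)
  refine ⟨max C 1, fun x hx => ?_⟩
  rcases le_total x R with hxR | hxR
  · exact (hC x ⟨hx, hxR⟩).trans (le_max_left _ _)
  · exact (hR x hxR).trans (le_max_right _ _)

/-- The derivative of the regularized modulus `√(‖y‖² + δ²)`. -/
lemma hasDerivAt_sqrt_normSq_add {y : ℝ → ℂ} {y' : ℂ} {x δ : ℝ} (hδ : 0 < δ)
    (hy : HasDerivAt y y' x) :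
    HasDerivAt (fun s => √(‖y s‖ ^ 2 + δ ^ 2))
      (inner ℝ (y x) y' / √(‖y x‖ ^ 2 + δ ^ 2)) x := by
  have h1 := (hy.norm_sq.add_const (δ ^ 2)).sqrt (by positivity)
  convert h1 using 1
  field_simp

/-- A solution of `y' = a y + f` on the half-line which vanishes at infinity is integrable,
provided that `f` is integrable and `a` is not purely imaginary. -/
lemma integrableOn_Ioi_of_hasDerivAt_mul_add {y f : ℝ → ℂ} {a : ℂ} (ha : a.re ≠ 0)
    (hc : ContinuousOn y (Ici 0)) (hlim : Tendsto y atTop (nhds 0))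
    (hf : IntegrableOn f (Ioi 0)) (hy : ∀ x > (0 : ℝ), HasDerivAt y (a * y x + f x) x) :
    IntegrableOn y (Ioi 0) := by
  obtain ⟨M, hM⟩ := exists_norm_le_of_continuousOn_of_tendsto_zero hc hlim
  set C : ℝ := ∫ x in Ioi (0 : ℝ), ‖f x‖ with hC
  have key : ∀ X > (0 : ℝ), ∫ x in (0 : ℝ)..X, ‖y x‖ ≤ (2 * (M + 1) + C) / |a.re| + 1 := by
    intro X hX
    set δ : ℝ := 1 / (X + 1) with hδdef
    have hδ : 0 < δ := by positivity
    have hδ1 : δ ≤ 1 := by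
      rw [hδdef, div_le_one (by positivity)]; linarith
    have hXδ : X * δ ≤ 1 := by
      rw [hδdef, mul_one_div, div_le_one (by positivity)]; linarith
    set r : ℝ → ℝ := fun x => √(‖y x‖ ^ 2 + δ ^ 2) with hr
    have hrpos : ∀ x, 0 < r x := fun x => Real.sqrt_pos.2 (by positivity)
    have hyr : ∀ x, ‖y x‖ ≤ r x := fun x => Real.le_sqrt_of_sq_le (by nlinarith)
    have hry : ∀ x, r x ≤ ‖y x‖ + δ := fun x =>
      Real.sqrt_le_iff.2 ⟨by positivity, by nlinarith [norm_nonneg (y x)]⟩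
    have hrM : ∀ x ≥ (0 : ℝ), r x ≤ M + 1 := fun x hx => by
      linarith [hry x, hM x hx]
    have hcX : ContinuousOn y (Icc 0 X) := hc.mono Icc_subset_Ici_self
    have hrc : ContinuousOn r (Icc 0 X) :=
      ((hcX.norm.pow 2).add continuousOn_const).sqrt
    have hA : IntervalIntegrable (fun x => ‖y x‖ ^ 2 / r x) volume 0 X := by
      refine ContinuousOn.intervalIntegrable_of_Icc hX.le ?_
      exact (hcX.norm.pow 2).div hrc fun x _ => (hrpos x).ne'
    have hfX : IntervalIntegrable f volume 0 X :=
      (intervalIntegrable_iff_integrableOn_Ioc_of_le hX.le).2 (hf.mono_set Ioc_subset_Ioi_self)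
    have hBle : ∀ x, ‖inner ℝ (y x) (f x) / r x‖ ≤ ‖f x‖ := fun x => by
      rw [norm_div, Real.norm_of_nonneg (hrpos x).le, div_le_iff₀ (hrpos x), mul_comm]
      exact (norm_inner_le_norm _ _).trans
        (mul_le_mul_of_nonneg_right (hyr x) (norm_nonneg _))
    have hB : IntervalIntegrable (fun x => inner ℝ (y x) (f x) / r x) volume 0 X := by
      refine hfX.norm.mono_fun' ?_ (ae_of_all _ hBle)
      rw [uIoc_of_le hX.le]
      have hym := (hcX.mono Ioc_subset_Icc_self).aestronglyMeasurable (μ := volume)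
        measurableSet_Ioc
      have hrm := (hrc.mono Ioc_subset_Icc_self).aestronglyMeasurable (μ := volume)
        measurableSet_Ioc
      exact ((hym.inner (hf.mono_set Ioc_subset_Ioi_self).aestronglyMeasurable).aemeasurable.div
        hrm.aemeasurable).aestronglyMeasurable
    have hFTC : ∫ x in (0 : ℝ)..X,
        (a.re * (‖y x‖ ^ 2 / r x) + inner ℝ (y x) (f x) / r x) = r X - r 0 := by
      refine intervalIntegral.integral_eq_sub_of_hasDerivAt_of_le hX.le hrc (fun x hx => ?_)
        ((hA.const_mul _).add hB)
      refine (hasDerivAt_sqrt_normSq_add hδ (hy x hx.1)).congr_deriv ?_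
      have hin : inner ℝ (y x) (a * y x) = a.re * ‖y x‖ ^ 2 := by
        rw [← Complex.normSq_eq_norm_sq, Complex.normSq_apply, Complex.inner]
        simp
        ring
      rw [inner_add_right, hin]
      simp only [hr]
      ring
    rw [intervalIntegral.integral_add (hA.const_mul _) hB,
      intervalIntegral.integral_const_mul] at hFTC
    have hBC : |∫ x in (0 : ℝ)..X, inner ℝ (y x) (f x) / r x| ≤ C := by
      calc _ ≤ ∫ x in (0 : ℝ)..X, ‖f x‖ :=
            intervalIntegral.norm_integral_le_of_norm_le hX.le (ae_of_all _ fun x _ => hBle x)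
              hfX.norm
        _ ≤ C := by
          rw [intervalIntegral.integral_of_le hX.le]
          exact setIntegral_mono_set hf.norm (ae_of_all _ fun x => norm_nonneg _)
            Ioc_subset_Ioi_self.eventuallyLE
    have hAbound : ∫ x in (0 : ℝ)..X, ‖y x‖ ^ 2 / r x ≤ (2 * (M + 1) + C) / |a.re| := by
      rw [le_div_iff₀ (abs_pos.2 ha)]
      refine (mul_comm _ _).trans_le ((mul_le_mul_of_nonneg_left (le_abs_self _)
        (abs_nonneg _)).trans ?_)
      rw [← abs_mul, eq_sub_of_add_eq hFTC]
      have h0 := hrM 0 le_rfl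
      have hrX := hrM X hX.le
      have hp0 := hrpos 0
      have hpX := hrpos X
      obtain ⟨hB1, hB2⟩ := abs_le.1 hBC
      rw [abs_le]
      constructor <;> linarith
    have hmono : ∫ x in (0 : ℝ)..X, ‖y x‖ ≤ ∫ x in (0 : ℝ)..X, (‖y x‖ ^ 2 / r x + δ) := by
      refine intervalIntegral.integral_mono_on hX.le (hcX.norm.intervalIntegrable_of_Icc hX.le)
        (hA.add intervalIntegrable_const) fun x _ => ?_
      rw [div_add' _ _ _ (hrpos x).ne', le_div_iff₀ (hrpos x)]
      nlinarith [hry x, hyr x, norm_nonneg (y x)]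
    rw [intervalIntegral.integral_add hA intervalIntegrable_const,
      intervalIntegral.integral_const, sub_zero, smul_eq_mul] at hmono
    linarith
  refine integrableOn_Ioi_of_intervalIntegral_norm_bounded
    ((2 * (M + 1) + C) / |a.re| + 1) 0 (fun X : ℝ => ?_) tendsto_id ?_
  · exact ((hc.mono Icc_subset_Ici_self).integrableOn_Icc).mono_set Ioc_subset_Icc_self
  · filter_upwards [eventually_gt_atTop 0] with X hX using key X hX

/-- If `D³V + κ V = g` on the half-line with `κ > 0` and `g` integrable, and if `V`, `DV`, `D²V`
vanish at infinity, then `V` is integrable: none of the roots of `ω³ = -κ` is imaginary. -/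
lemma integrableOn_Ioi_of_third_order {V V₁ V₂ g : ℝ → ℝ} {κ : ℝ} (hκ : 0 < κ)
    (hc : ContinuousOn V (Ici 0)) (hc₁ : ContinuousOn V₁ (Ici 0)) (hc₂ : ContinuousOn V₂ (Ici 0))
    (hl : Tendsto V atTop (nhds 0)) (hl₁ : Tendsto V₁ atTop (nhds 0))
    (hl₂ : Tendsto V₂ atTop (nhds 0)) (hg : IntegrableOn g (Ioi 0))
    (hV : ∀ x > (0 : ℝ), HasDerivAt V (V₁ x) x) (hV₁ : ∀ x > (0 : ℝ), HasDerivAt V₁ (V₂ x) x)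
    (hV₂ : ∀ x > (0 : ℝ), HasDerivAt V₂ (g x - κ * V x) x) :
    IntegrableOn V (Ioi 0) := by
  have hmode : ∀ ω : ℂ, ω.re ≠ 0 → ω ^ 3 = -κ →
      IntegrableOn (fun x => (V₂ x : ℂ) + ω * V₁ x + ω ^ 2 * V x) (Ioi 0) := by
    intro ω hω hω3
    refine integrableOn_Ioi_of_hasDerivAt_mul_add hω ?_ ?_ hg.ofReal fun x hx => ?_
    · have hr : ∀ {v : ℝ → ℝ}, ContinuousOn v (Ici 0) →
          ContinuousOn (fun x => (v x : ℂ)) (Ici 0) := fun hv =>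
        Complex.continuous_ofReal.comp_continuousOn hv
      exact ((hr hc₂).add (continuousOn_const.mul (hr hc₁))).add (continuousOn_const.mul (hr hc))
    · have hL := (hl₂.ofReal).add ((hl₁.ofReal).const_mul ω)
      simpa using hL.add ((hl.ofReal).const_mul (ω ^ 2))
    · refine (((hV₂ x hx).ofReal_comp.fun_add ((hV₁ x hx).ofReal_comp.const_mul ω)).fun_add
        ((hV x hx).ofReal_comp.const_mul (ω ^ 2))).congr_deriv ?_
      push_cast
      linear_combination -(V x : ℂ) * hω3
  obtain ⟨k, hk, rfl⟩ : ∃ k : ℝ, 0 < k ∧ k ^ 3 = κ :=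
    ⟨κ ^ (1 / 3 : ℝ), by positivity, by rw [← Real.rpow_natCast, ← Real.rpow_mul hκ.le]; norm_num⟩
  have h3 : ((√3 : ℝ) : ℂ) ^ 2 = 3 := by
    rw [← Complex.ofReal_pow, Real.sq_sqrt (by norm_num)]
    norm_num
  set s : ℂ := ((√3 : ℝ) : ℂ) * Complex.I with hs
  have hs2 : s ^ 2 = -3 := by rw [hs, mul_pow, h3, Complex.I_sq]; ring
  have hs_re : s.re = 0 := by simp [hs]
  have h₀ := hmode (-k) (by simpa using hk.ne') (by push_cast; ring)
  have h₁ := hmode ((k / 2 : ℝ) * (1 + s)) (by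
    rw [Complex.re_ofReal_mul, Complex.add_re, hs_re]; simpa using hk.ne') (by
    push_cast
    linear_combination (k : ℂ) ^ 3 / 8 * (3 + s) * hs2)
  have h₂ := hmode ((k / 2 : ℝ) * (1 - s)) (by
    rw [Complex.re_ofReal_mul, Complex.sub_re, hs_re]; simpa using hk.ne') (by
    push_cast
    linear_combination (k : ℂ) ^ 3 / 8 * (3 - s) * hs2)
  have hsum := ((h₀.const_mul (-(k : ℂ))).add (h₁.const_mul ((k / 2 : ℝ) * (1 + s)))).add
    (h₂.const_mul ((k / 2 : ℝ) * (1 - s)))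
  have hVC : IntegrableOn (fun x => (V x : ℂ)) (Ioi 0) := by
    refine IntegrableOn.congr_fun (hsum.const_mul (-(1 / (3 * (k : ℂ) ^ 3)))) (fun x _ => ?_)
      measurableSet_Ioi
    have hk_ne : (k : ℂ) ≠ 0 := by exact_mod_cast hk.ne'
    simp only [Pi.add_apply]
    rw [neg_mul, neg_eq_iff_eq_neg, one_div_mul_eq_div, div_eq_iff (by simpa using hk_ne)]
    push_cast
    linear_combination ((k : ℂ) ^ 2 / 2 * V₁ x + 3 / 4 * (k : ℂ) ^ 3 * V x) * hs2
  exact hVC.re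

/-- With `F_ε(t,x) = ∫₀ˣ P_ε(t,y) dy`, for each `t > 0` the
limit of `F_ε(t,x)` as `x → ∞` exists and equals
`∫₀^∞ P_ε(t,y) dy = (ε/γ) ∂ₜ∂ₓP_ε(t,0) + (ε/γ) ∂ₓu_ε(t,0)`. -/
theorem viscous_SPE_halfline_F_limit
    (γ ε : ℝ) (hγ : 0 < γ) (hε : ε ∈ Set.Ioo (0:ℝ) 1)
    (u P ut ux uxx Px Pxx Ptx : ℝ → ℝ → ℝ)
    (h : ViscousSPEHalf γ ε u P ut ux uxx Px Pxx)
    (hPtx : ∀ t x : ℝ, HasDerivAt (fun τ => Px τ x) (Ptx t x) t)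
    (huL1 : ∀ t > (0:ℝ), IntegrableOn (u t) (Set.Ioi 0))
    (hutL1 : ∀ t > (0:ℝ), IntegrableOn (ut t) (Set.Ioi 0))
    (hdu3 : ∀ t > (0:ℝ), Tendsto (fun x => (u t x) ^ 3) atTop (nhds 0))
    (hdiff : ∀ t > (0:ℝ),
      HasDerivAt (fun τ => ∫ x in Set.Ioi (0:ℝ), u τ x)
        (∫ x in Set.Ioi (0:ℝ), ut t x) t) :
    ∀ t > (0:ℝ),
      IntegrableOn (P t) (Set.Ioi 0) ∧
      Tendsto (fun X => ∫ y in (0:ℝ)..X, P t y) atTop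
        (nhds (∫ y in Set.Ioi (0:ℝ), P t y)) ∧
      (∫ y in Set.Ioi (0:ℝ), P t y) = ε / γ * Ptx t 0 + ε / γ * ux t 0 := by
  obtain ⟨hε0, -⟩ := hε
  have hPx_cont : ∀ t, Continuous (Px t) := fun t =>
    continuous_iff_continuousAt.2 fun x => (h.hPxx t x).continuousAt
  have hP_cont : ∀ t, Continuous (P t) := fun t =>
    continuous_iff_continuousAt.2 fun x => (h.hPx t x).continuousAt
  have hu_cont : ∀ t, Continuous (u t) := fun t =>
    continuous_iff_continuousAt.2 fun x => (h.hux t x).continuousAt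
  have hux_cont : ∀ t, Continuous (ux t) := fun t =>
    continuous_iff_continuousAt.2 fun x => (h.huxx t x).continuousAt
  -- the tail integral `∫ₓ^∞ u` in terms of `P`
  have hU_deriv : ∀ t > (0 : ℝ), ∀ x > (0 : ℝ),
      HasDerivAt (fun x => ε * Px t x - P t x) (-u t x) x := fun t ht x hx => by
    refine (((h.hPxx t x).const_mul ε).fun_sub (h.hPx t x)).congr_deriv ?_
    linarith [h.heqP t ht x hx]
  have hU_lim : ∀ t > (0 : ℝ), Tendsto (fun x => ε * Px t x - P t x) atTop (nhds 0) :=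
    fun t ht => by simpa using ((h.hdPx t ht).const_mul ε).sub (h.hdP t ht)
  have hmass : ∀ t > (0 : ℝ), ∫ x in Ioi (0 : ℝ), u t x = ε * Px t 0 := fun t ht => by
    have hI := integral_Ioi_of_hasDerivAt_of_tendsto (a := 0)
      (f := fun x => ε * Px t x - P t x) (f' := fun x => -u t x)
      (((hPx_cont t).const_mul ε).sub (hP_cont t)).continuousWithinAt
      (hU_deriv t ht) (huL1 t ht).neg (hU_lim t ht)
    simp only [integral_neg, h.hbP] at hI
    linarith
  have hmass_deriv : ∀ t > (0 : ℝ), ∫ x in Ioi (0 : ℝ), ut t x = ε * Ptx t 0 := fun t ht => by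
    refine (hdiff t ht).unique (((hPtx t 0).const_mul ε).congr_of_eventuallyEq ?_)
    filter_upwards [lt_mem_nhds ht] with τ hτ using hmass τ hτ
  intro t ht
  have hPx_int : IntegrableOn (Px t) (Ioi 0) := by
    have hI : IntegrableOn (fun x => (Px t x : ℂ)) (Ioi 0) := by
      refine integrableOn_Ioi_of_hasDerivAt_mul_add (a := ((1 / ε : ℝ) : ℂ))
        (f := fun x => ((-(1 / ε) * u t x : ℝ) : ℂ)) ?_
        (Complex.continuous_ofReal.comp (hPx_cont t)).continuousOn ?_
        ((huL1 t ht).const_mul _).ofReal fun x hx => ?_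
      · rw [Complex.ofReal_re]; positivity
      · simpa using (h.hdPx t ht).ofReal
      · refine (h.hPxx t x).ofReal_comp.congr_deriv ?_
        rw [← Complex.ofReal_mul, ← Complex.ofReal_add, ← h.heqP t ht x hx]
        congr 1
        field_simp
        ring
    exact hI.re
  have hcubic_int : IntegrableOn (fun x => 1 / 2 * (u t x) ^ 2 * ux t x) (Ioi 0) := by
    obtain ⟨M, hM⟩ :=
      exists_norm_le_of_continuousOn_of_tendsto_zero (hu_cont t).continuousOn (h.hdu t ht)
    refine Integrable.mono' (((h.huL2 t ht).add (h.huxL2 t ht)).const_mul M)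
      ((((hu_cont t).pow 2).const_mul (1 / 2)).mul (hux_cont t)).aestronglyMeasurable ?_
    filter_upwards [ae_restrict_mem measurableSet_Ioi] with x hx
    have hu := hM x (le_of_lt hx)
    simp only [Real.norm_eq_abs, Pi.add_apply, abs_mul, abs_pow] at hu ⊢
    rw [abs_of_pos (by norm_num : (0 : ℝ) < 1 / 2), ← sq_abs (u t x), ← sq_abs (ux t x)]
    nlinarith [mul_le_mul_of_nonneg_right hu (add_nonneg (sq_nonneg |u t x|) (sq_nonneg |ux t x|)),
      mul_nonneg (abs_nonneg (u t x)) (sq_nonneg (|u t x| - |ux t x|)),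
      mul_nonneg (abs_nonneg (u t x)) (add_nonneg (sq_nonneg |u t x|) (sq_nonneg |ux t x|))]
  have hP_int : IntegrableOn (P t) (Ioi 0) := by
    have hforce : IntegrableOn
        (fun x => ut t x - 1 / 2 * (u t x) ^ 2 * ux t x - γ * ε * Px t x) (Ioi 0) :=
      ((hutL1 t ht).sub hcubic_int).sub (hPx_int.const_mul (γ * ε))
    have hU_int : IntegrableOn (fun x => ε * Px t x - P t x) (Ioi 0) := by
      refine integrableOn_Ioi_of_third_order (κ := γ / ε) (V₁ := fun x => -u t x)
        (V₂ := fun x => -ux t x)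
        (g := fun x => -(1 / ε) * (ut t x - 1 / 2 * (u t x) ^ 2 * ux t x - γ * ε * Px t x))
        (div_pos hγ hε0) (((hPx_cont t).const_mul ε).sub (hP_cont t)).continuousOn
        (hu_cont t).neg.continuousOn (hux_cont t).neg.continuousOn
        (hU_lim t ht) (by simpa using (h.hdu t ht).neg) (by simpa using (h.hdux t ht).neg)
        (hforce.const_mul _)
        (hU_deriv t ht) (fun x _ => (h.hux t x).fun_neg) fun x hx => ?_
      refine (h.huxx t x).fun_neg.congr_deriv ?_
      field_simp
      linarith [h.hequ t ht x hx]
    refine IntegrableOn.congr_fun ((hPx_int.const_mul ε).sub hU_int) (fun x _ => ?_)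
      measurableSet_Ioi
    simp
  refine ⟨hP_int, intervalIntegral_tendsto_integral_Ioi 0 hP_int tendsto_id, ?_⟩
  have hflux := integral_Ioi_of_hasDerivAt_of_tendsto' (a := 0) (m := 0)
    (f := fun x => 1 / 6 * (u t x) ^ 3 + ε * ux t x)
    (f' := fun x => 1 / 2 * (u t x) ^ 2 * ux t x + ε * uxx t x)
    (fun x _ => ?_) ?_ ?_
  · have hcongr : ∫ x in Ioi (0 : ℝ), (1 / 2 * (u t x) ^ 2 * ux t x + ε * uxx t x)
        = ∫ x in Ioi (0 : ℝ), (ut t x - γ * P t x) :=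
      setIntegral_congr_fun measurableSet_Ioi fun x hx => by
        have := h.hequ t ht x hx
        linarith
    rw [hcongr, integral_sub (hutL1 t ht) (hP_int.const_mul γ), integral_const_mul,
      hmass_deriv t ht, h.hbu] at hflux
    field_simp
    linarith
  · refine ((((h.hux t x).fun_pow 3).const_mul (1 / 6)).fun_add
      ((h.huxx t x).const_mul ε)).congr_deriv ?_
    push_cast
    ring
  · refine ((hutL1 t ht).sub (hP_int.const_mul γ)).congr_fun (fun x hx => ?_) measurableSet_Ioi
    have := h.hequ t ht x hx
    simp only [Pi.sub_apply]
    linarith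
  · simpa only [mul_zero, add_zero] using ((hdu3 t ht).const_mul (1 / 6)).add ((h.hdux t ht).const_mul ε)
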